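/- For every nontrivial character θ : T → k*, every kG-module homomorphism from V₋ to the induced module M(θ) is zero; i.e., Hom_{kG}(V₋, M(θ)) = 0. -/

import Mathlib

noncomputable section

open scoped TensorProduct

namespace SL2X

variable (p : ℕ) [Fact p.Prime]

/-- The algebraic closure of the prime field `𝔽_p`. -/
abbrev F : Type := AlgebraicClosure (ZMod p)

/-- `G = SL₂(F)`. -/
abbrev G : Type := Matrix.SpecialLinearGroup (Fin 2) (F p)

/-- The unipotent element `ε(x) = [[1,x],[0,1]]`. -/
def eps (x : F p) : G p :=
  ⟨!![1, x; 0, 1], by simp [Matrix.det_fin_two_of]⟩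

/-- The torus element `h(t) = diag(t, t⁻¹)`. -/
def h (t : (F p)ˣ) : G p :=
  ⟨!![(t : F p), 0; 0, ((t⁻¹ : (F p)ˣ) : F p)], by simp [Matrix.det_fin_two_of]⟩

/-- The Weyl element `s = [[0,1],[-1,0]]`. -/
def sG : G p :=
  ⟨!![0, 1; -1, 0], by simp [Matrix.det_fin_two_of]⟩

/-- The Borel subgroup `B` of upper triangular matrices in `G`. -/
def B : Subgroup (G p) where
  carrier := {g | (g : Matrix (Fin 2) (Fin 2) (F p)) 1 0 = 0}
  one_mem' := by simp [Matrix.one_apply]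
  mul_mem' := by
    intro a b ha hb
    simp only [Set.mem_setOf_eq] at *
    simp [Matrix.mul_apply, Fin.sum_univ_two, ha, hb]
  inv_mem' := by
    intro a ha
    simp only [Set.mem_setOf_eq] at *
    simp [Matrix.SpecialLinearGroup.coe_inv, Matrix.adjugate_fin_two, ha]

/-- The diagonal part of an element of `B`, as a unit of `F`. -/
def Bdiag (b : B p) : (F p)ˣ where
  val := ((b : G p) : Matrix (Fin 2) (Fin 2) (F p)) 0 0
  inv := ((b : G p) : Matrix (Fin 2) (Fin 2) (F p)) 1 1
  val_inv := by
    have hdet : ((b : G p) : Matrix (Fin 2) (Fin 2) (F p)).det = 1 := (b : G p).2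
    have h10 : ((b : G p) : Matrix (Fin 2) (Fin 2) (F p)) 1 0 = 0 := b.2
    rw [Matrix.det_fin_two, h10, mul_zero, sub_zero] at hdet
    exact hdet
  inv_val := by
    have hdet : ((b : G p) : Matrix (Fin 2) (Fin 2) (F p)).det = 1 := (b : G p).2
    have h10 : ((b : G p) : Matrix (Fin 2) (Fin 2) (F p)) 1 0 = 0 := b.2
    rw [Matrix.det_fin_two, h10, mul_zero, sub_zero] at hdet
    rw [mul_comm]; exact hdet

variable (k : Type) [Field k] [IsAlgClosed k] [CharZero k]

/-- The group algebra `kG`. -/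
abbrev kG : Type := MonoidAlgebra k (G p)

/-- The canonical image of a group element in the group algebra. -/
def γ (g : G p) : kG p k := MonoidAlgebra.of k (G p) g

/-- The submodule of relations defining the induced module
`M(θ) = kG ⊗_{kB} k_θ`, where the character `θ` of `T ≅ Fˣ` is extended to `B`
by letting `U` act trivially. -/
def Nmod (θ : (F p)ˣ →* kˣ) : Submodule (kG p k) (kG p k) :=
  Submodule.span (kG p k)
    {y | ∃ b : B p, y = γ p k (b : G p) - ((θ (Bdiag p b) : k)) • (1 : kG p k)}

/-- The induced module `M(θ) = kG ⊗_{kB} k_θ`, realized as `kG / N(θ)` where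
`N(θ)` is the left submodule generated by the elements `b - θ(b)·1`, `b ∈ B`. -/
def Mmod (θ : (F p)ˣ →* kˣ) : Type := kG p k ⧸ Nmod p k θ

instance (θ : (F p)ˣ →* kˣ) : AddCommGroup (Mmod p k θ) :=
  inferInstanceAs (AddCommGroup (kG p k ⧸ Nmod p k θ))
instance (θ : (F p)ˣ →* kˣ) : Module (kG p k) (Mmod p k θ) :=
  inferInstanceAs (Module (kG p k) (kG p k ⧸ Nmod p k θ))
instance (θ : (F p)ˣ →* kˣ) : Module k (Mmod p k θ) :=
  inferInstanceAs (Module k (kG p k ⧸ Nmod p k θ))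
instance (θ : (F p)ˣ →* kˣ) : IsScalarTower k (kG p k) (Mmod p k θ) :=
  inferInstanceAs (IsScalarTower k (kG p k) (kG p k ⧸ Nmod p k θ))

/-- The canonical generator `1_θ ∈ M(θ)`. -/
def oneθ (θ : (F p)ˣ →* kˣ) : Mmod p k θ :=
  Submodule.Quotient.mk (1 : kG p k)

/-- `η = (1 - s)·1_tr ∈ M(tr)`. -/
def eta : Mmod p k 1 :=
  Submodule.Quotient.mk ((1 : kG p k) - γ p k (sG p))

/-- The Steinberg module `St = kG·η ⊆ M(tr)`. -/
def St : Submodule (kG p k) (Mmod p k 1) :=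
  Submodule.span (kG p k) {eta p k}

/-- `ε(x)·η` as an element of `St`. -/
def E (x : F p) : ↥(St p k) :=
  ⟨γ p k (eps p x) • eta p k,
    Submodule.smul_mem _ _ (Submodule.mem_span_singleton_self _)⟩

/-- The action of a group element on `St`, as a `k`-linear map. -/
def gSt (g : G p) : ↥(St p k) →ₗ[k] ↥(St p k) where
  toFun v := ⟨γ p k g • (v : Mmod p k 1), Submodule.smul_mem _ _ v.2⟩
  map_add' := by intro a b; apply Subtype.ext; simp [smul_add]
  map_smul' := by
    intro c v; apply Subtype.ext
    simp [smul_comm (γ p k g) c]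

/-- `St ⊗_k St`. -/
abbrev StT : Type := ↥(St p k) ⊗[k] ↥(St p k)

/-- The diagonal action of a group element on `St ⊗_k St`. -/
def gTT (g : G p) : StT p k →ₗ[k] StT p k :=
  TensorProduct.map (gSt p k g) (gSt p k g)

/-- `ω_{x,y} = (ε(x)η ⊗ ε(y)η + ε(y)η ⊗ ε(x)η)/2`. -/
def ω (x y : F p) : StT p k :=
  (2 : k)⁻¹ • (E p k x ⊗ₜ[k] E p k y + E p k y ⊗ₜ[k] E p k x)

/-- `ρ_{x,y} = (ε(x)η ⊗ ε(y)η − ε(y)η ⊗ ε(x)η)/2`. -/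
def ρ (x y : F p) : StT p k :=
  (2 : k)⁻¹ • (E p k x ⊗ₜ[k] E p k y - E p k y ⊗ₜ[k] E p k x)

/-- `V₊`, the span of the `ω_{x,y}`. -/
def Vplus : Submodule k (StT p k) :=
  Submodule.span k {v | ∃ x y : F p, v = ω p k x y}

/-- `V₋`, the span of the `ρ_{x,y}` for `x ≠ y`. -/
def Vminus : Submodule k (StT p k) :=
  Submodule.span k {v | ∃ x y : F p, x ≠ y ∧ v = ρ p k x y}


lemma γ_mul (g g' : G p) : γ p k (g * g') = γ p k g * γ p k g' :=
  map_mul (MonoidAlgebra.of k (G p)) g g'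

lemma γ_one : γ p k 1 = 1 := map_one (MonoidAlgebra.of k (G p))

variable {p k} in
lemma kG_induction {P : kG p k → Prop} (x : kG p k) (zero : P 0)
    (add : ∀ a b, P a → P b → P (a + b)) (smul_γ : ∀ (c : k) (g : G p), P (c • γ p k g)) :
    P x := by
  refine MonoidAlgebra.induction_linear x zero (fun a b ha hb => add a b ha hb) fun g c => ?_
  have := smul_γ c g
  rwa [γ, MonoidAlgebra.smul_of] at this

lemma coe_eps (x : F p) : (eps p x : Matrix (Fin 2) (Fin 2) (F p)) = !![1, x; 0, 1] := rfl

lemma coe_h (t : (F p)ˣ) : (h p t : Matrix (Fin 2) (Fin 2) (F p)) =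
    !![(t : F p), 0; 0, ((t⁻¹ : (F p)ˣ) : F p)] := rfl

lemma coe_sG : (sG p : Matrix (Fin 2) (Fin 2) (F p)) = !![0, 1; -1, 0] := rfl

lemma mem_B_iff (g : G p) :
    g ∈ B p ↔ (g : Matrix (Fin 2) (Fin 2) (F p)) 1 0 = 0 := Iff.rfl

lemma Bdiag_mul (b b' : B p) : Bdiag p (b * b') = Bdiag p b * Bdiag p b' := by
  apply Units.ext
  have h10 : ((b' : G p) : Matrix (Fin 2) (Fin 2) (F p)) 1 0 = 0 := b'.2
  simp [Bdiag, Matrix.mul_apply, Fin.sum_univ_two, h10]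

section InducedModule

variable (θ : (F p)ˣ →* kˣ)

open Classical in
/-- The character `θ` of `B`, extended by zero to `G`. -/
def extChar (g : G p) : k := if hg : g ∈ B p then (θ (Bdiag p ⟨g, hg⟩) : k) else 0

lemma extChar_of_mem {g : G p} (hg : g ∈ B p) :
    extChar p k θ g = (θ (Bdiag p ⟨g, hg⟩) : k) := dif_pos hg

lemma extChar_of_notMem {g : G p} (hg : g ∉ B p) : extChar p k θ g = 0 := dif_neg hg

lemma extChar_mul_right (g : G p) (b : B p) :
    extChar p k θ (g * b) = extChar p k θ g * θ (Bdiag p b) := by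
  by_cases hg : g ∈ B p
  · rw [extChar_of_mem p k θ hg, extChar_of_mem p k θ ((B p).mul_mem hg b.2)]
    have : (⟨g * b, (B p).mul_mem hg b.2⟩ : B p) = ⟨g, hg⟩ * b := rfl
    rw [this, Bdiag_mul, map_mul, Units.val_mul]
  · rw [extChar_of_notMem p k θ hg, extChar_of_notMem p k θ, zero_mul]
    rwa [(B p).mul_mem_cancel_right b.2]

lemma extChar_mul_left (b : B p) (g : G p) :
    extChar p k θ (b * g) = θ (Bdiag p b) * extChar p k θ g := by
  by_cases hg : g ∈ B p
  · rw [extChar_of_mem p k θ hg, extChar_of_mem p k θ ((B p).mul_mem b.2 hg)]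
    have : (⟨b * g, (B p).mul_mem b.2 hg⟩ : B p) = b * ⟨g, hg⟩ := rfl
    rw [this, Bdiag_mul, map_mul, Units.val_mul]
  · rw [extChar_of_notMem p k θ hg, extChar_of_notMem p k θ, mul_zero]
    rwa [(B p).mul_mem_cancel_left b.2]

/-- The linear extension of `extChar` to the group algebra. -/
def extCharLin : kG p k →ₗ[k] k := (MonoidAlgebra.basis (G p) k).constr k (extChar p k θ)

lemma extCharLin_γ (g : G p) : extCharLin p k θ (γ p k g) = extChar p k θ g :=
  (MonoidAlgebra.basis (G p) k).constr_basis k (extChar p k θ) g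

lemma extCharLin_mul_sub (y : kG p k) (b : B p) :
    extCharLin p k θ (y * (γ p k (b : G p) - (θ (Bdiag p b) : k) • (1 : kG p k))) = 0 := by
  induction y using kG_induction with
  | zero => simp
  | add a c ha hc => rw [add_mul, map_add, ha, hc, add_zero]
  | smul_γ c g =>
  rw [smul_mul_assoc, mul_sub, ← γ_mul, mul_smul_comm, mul_one, map_smul, map_sub, map_smul,
    extCharLin_γ, extCharLin_γ, extChar_mul_right]
  simp [mul_comm]

lemma extCharLin_Nmod {x : kG p k} (hx : x ∈ Nmod p k θ) : extCharLin p k θ x = 0 := by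
  suffices ∀ y, extCharLin p k θ (y * x) = 0 by simpa using this 1
  induction hx using Submodule.span_induction with
  | mem x hx =>
    obtain ⟨b, rfl⟩ := hx
    exact fun y => extCharLin_mul_sub p k θ y b
  | zero => simp
  | add a b _ _ ha hb => intro y; rw [mul_add, map_add, ha, hb, add_zero]
  | smul r a _ ha => intro y; rw [smul_eq_mul, ← mul_assoc]; exact ha _

/-- The coefficient of `1_θ` in an element of `M(θ)`. -/
def oneCoeff : Mmod p k θ →ₗ[k] k :=
  ((Nmod p k θ).restrictScalars k).liftQ (extCharLin p k θ)
    fun _ hx => extCharLin_Nmod p k θ hx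

/-- The quotient map `kG → M(θ)`. -/
def toMmod (x : kG p k) : Mmod p k θ := Submodule.Quotient.mk x

lemma toMmod_surjective : Function.Surjective (toMmod p k θ) := Submodule.Quotient.mk_surjective _

lemma smul_toMmod (x y : kG p k) : x • toMmod p k θ y = toMmod p k θ (x * y) := rfl

lemma oneCoeff_toMmod (x : kG p k) : oneCoeff p k θ (toMmod p k θ x) = extCharLin p k θ x := rfl

lemma oneCoeff_smul (b : B p) (m : Mmod p k θ) :
    oneCoeff p k θ (γ p k (b : G p) • m) = θ (Bdiag p b) * oneCoeff p k θ m := by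
  obtain ⟨x, rfl⟩ := toMmod_surjective p k θ m
  rw [smul_toMmod, oneCoeff_toMmod, oneCoeff_toMmod]
  induction x using kG_induction with
  | zero => simp
  | add a c ha hc => rw [mul_add, map_add, map_add, ha, hc, mul_add]
  | smul_γ c g =>
  rw [mul_smul_comm, map_smul, map_smul, ← γ_mul, extCharLin_γ, extCharLin_γ, extChar_mul_left]
  simp only [smul_eq_mul]; ring

lemma sG_mul_eps_mul_mem_B_iff (x : F p) (g : G p) :
    sG p * (eps p x * g) ∈ B p ↔ g.1 0 0 + x * g.1 1 0 = 0 := by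
  rw [mem_B_iff, ← neg_eq_zero]
  simp [coe_eps, coe_sG, Matrix.vecMul, dotProduct, Fin.sum_univ_two]

lemma finite_oneCoeff_ne_zero (m : Mmod p k θ) :
    {x : F p | oneCoeff p k θ (γ p k (sG p * eps p x) • m) ≠ 0}.Finite := by
  obtain ⟨y, rfl⟩ := toMmod_surjective p k θ m
  simp only [smul_toMmod, oneCoeff_toMmod]
  induction y using kG_induction with
  | zero => simp
  | add a c ha hc =>
    refine (ha.union hc).subset fun x hx => ?_
    by_contra hcon
    simp only [Set.mem_union, Set.mem_ofPred_eq, not_or, not_not] at hcon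
    exact hx (by rw [mul_add, map_add, hcon.1, hcon.2, add_zero])
  | smul_γ c g =>
    refine (Set.finite_singleton (-g.1 0 0 / g.1 1 0)).subset fun x hx => ?_
    have hmem : sG p * (eps p x * g) ∈ B p := by
      by_contra hcon
      refine hx ?_
      rw [mul_smul_comm, map_smul, ← γ_mul, mul_assoc, extCharLin_γ,
        extChar_of_notMem p k θ hcon, smul_zero]
    rw [sG_mul_eps_mul_mem_B_iff] at hmem
    have hdet := g.2
    rw [Matrix.det_fin_two] at hdet
    have h10 : g.1 1 0 ≠ 0 := by
      intro h0
      rw [h0, mul_zero, add_zero] at hmem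
      rw [h0, hmem] at hdet
      simp at hdet
    rw [Set.mem_singleton_iff, eq_div_iff h10]
    linear_combination hmem

/-- A chosen representative of the coset `gB`. -/
def cosetRep (g : G p) : G p := (QuotientGroup.mk g : G p ⧸ B p).out

lemma cosetRep_eq_iff (g g' : G p) : cosetRep p g = cosetRep p g' ↔ g⁻¹ * g' ∈ B p := by
  rw [cosetRep, cosetRep, Quotient.out_inj, QuotientGroup.eq]

lemma cosetRep_cosetRep (g : G p) : cosetRep p (cosetRep p g) = cosetRep p g := by
  rw [cosetRep, cosetRep, QuotientGroup.out_eq']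

/-- The projection of `kG` onto the span of the coset representatives, with kernel `N(θ)`. -/
def repProj : kG p k →ₗ[k] kG p k := (MonoidAlgebra.basis (G p) k).constr k
  fun g => extChar p k θ ((cosetRep p g)⁻¹ * g) • γ p k (cosetRep p g)

lemma repProj_γ (g : G p) : repProj p k θ (γ p k g) =
    extChar p k θ ((cosetRep p g)⁻¹ * g) • γ p k (cosetRep p g) :=
  (MonoidAlgebra.basis (G p) k).constr_basis k _ g

lemma smul_mem_Nmod (c : k) {x : kG p k} (hx : x ∈ Nmod p k θ) : c • x ∈ Nmod p k θ :=
  ((Nmod p k θ).restrictScalars k).smul_mem c hx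

lemma sub_repProj_mem (x : kG p k) : x - repProj p k θ x ∈ Nmod p k θ := by
  induction x using kG_induction with
  | zero => simp
  | add a c ha hc =>
    rw [map_add, add_sub_add_comm]
    exact add_mem ha hc
  | smul_γ c g =>
    rw [map_smul, ← smul_sub]
    refine smul_mem_Nmod p k θ c ?_
    have hb : (cosetRep p g)⁻¹ * g ∈ B p := by
      rw [← cosetRep_eq_iff, cosetRep_cosetRep]
    rw [repProj_γ, extChar_of_mem p k θ hb]
    have := (Nmod p k θ).smul_mem (γ p k (cosetRep p g)) (Submodule.subset_span ⟨⟨_, hb⟩, rfl⟩)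
    rwa [smul_eq_mul, mul_sub, ← γ_mul, mul_inv_cancel_left, mul_smul_comm, mul_one] at this

open Classical in
lemma coeff_repProj (x : kG p k) (g : G p) : (repProj p k θ x).coeff g =
    if cosetRep p g = g then extCharLin p k θ (γ p k g⁻¹ * x) else 0 := by
  induction x using kG_induction with
  | zero => simp
  | add a c ha hc =>
    rw [map_add, MonoidAlgebra.coeff_add, Finsupp.add_apply, ha, hc, mul_add, map_add]
    split_ifs <;> simp
  | smul_γ c g' =>
    rw [map_smul, repProj_γ, mul_smul_comm, ← γ_mul, map_smul, extCharLin_γ]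
    have hco : (γ p k (cosetRep p g')).coeff g = if cosetRep p g' = g then 1 else 0 := by
      simp [γ, Finsupp.single_apply]
    rw [MonoidAlgebra.coeff_smul, MonoidAlgebra.coeff_smul, Finsupp.smul_apply,
      Finsupp.smul_apply, hco]
    by_cases hg : cosetRep p g' = g
    · subst hg
      simp [cosetRep_cosetRep]
    · rw [if_neg hg]
      split_ifs with hgg
      · have hB : g⁻¹ * g' ∉ B p := by
          rw [← cosetRep_eq_iff, hgg]
          exact fun e => hg e.symm
        rw [extChar_of_notMem p k θ hB, smul_zero]
      · simp

lemma eq_zero_of_oneCoeff_smul {m : Mmod p k θ}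
    (hm : ∀ g : G p, oneCoeff p k θ (γ p k g • m) = 0) : m = 0 := by
  classical
  obtain ⟨x, rfl⟩ := toMmod_surjective p k θ m
  have hx : repProj p k θ x = 0 := by
    ext g
    rw [coeff_repProj]
    split_ifs
    · exact hm g⁻¹
    · rfl
  have := sub_repProj_mem p k θ x
  rw [hx, sub_zero] at this
  exact (Submodule.Quotient.mk_eq_zero _).2 this

lemma toMmod_one_eq {g g' : G p}
    (hg : (g : Matrix (Fin 2) (Fin 2) (F p)) 0 0 * (g' : Matrix (Fin 2) (Fin 2) (F p)) 1 0 =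
      (g : Matrix (Fin 2) (Fin 2) (F p)) 1 0 * (g' : Matrix (Fin 2) (Fin 2) (F p)) 0 0) :
    toMmod p k 1 (γ p k g') = toMmod p k 1 (γ p k g) := by
  have hB : g⁻¹ * g' ∈ B p := by
    rw [mem_B_iff, Matrix.SpecialLinearGroup.coe_mul, Matrix.SpecialLinearGroup.coe_inv,
      Matrix.adjugate_fin_two, Matrix.mul_apply, Fin.sum_univ_two]
    simp [hg]
  refine (Submodule.Quotient.eq _).2 ?_
  have := (Nmod p k 1).smul_mem (γ p k g) (Submodule.subset_span ⟨⟨_, hB⟩, rfl⟩)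
  rwa [smul_eq_mul, mul_sub, ← γ_mul, mul_inv_cancel_left, mul_smul_comm, mul_one,
    MonoidHom.one_apply, Units.val_one, one_smul] at this

lemma toMmod_sub (x y : kG p k) : toMmod p k θ (x - y) = toMmod p k θ x - toMmod p k θ y := rfl

lemma coe_gSt_E (g : G p) (x : F p) : (gSt p k g (E p k x) : Mmod p k 1) =
    toMmod p k 1 (γ p k g) - toMmod p k 1 (γ p k (g * (eps p x * sG p))) := by
  change toMmod p k 1 (γ p k g * (γ p k (eps p x) * (1 - γ p k (sG p)))) = _
  rw [mul_sub, mul_sub, mul_one, ← γ_mul, ← γ_mul, ← γ_mul, toMmod_sub,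
    toMmod_one_eq p k (g := g) (g' := g * eps p x)]
  simp [coe_eps, Matrix.mul_apply, Fin.sum_univ_two]
  ring

lemma coe_E (x : F p) : (E p k x : Mmod p k 1) =
    toMmod p k 1 (γ p k 1) - toMmod p k 1 (γ p k (eps p x * sG p)) := by
  have := coe_gSt_E p k 1 x
  rw [one_mul] at this
  rw [← this]
  change _ = γ p k 1 • (E p k x : Mmod p k 1)
  rw [γ_one, one_smul]

lemma gSt_eps_E (z x : F p) : gSt p k (eps p z) (E p k x) = E p k (z + x) := by
  apply Subtype.ext
  rw [coe_gSt_E, coe_E]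
  refine congrArg₂ (· - ·) (toMmod_one_eq p k ?_) (toMmod_one_eq p k ?_) <;>
    simp [coe_eps, coe_sG, add_comm]

lemma gSt_h_E (t : (F p)ˣ) (x : F p) : gSt p k (h p t) (E p k x) = E p k (t ^ 2 * x) := by
  apply Subtype.ext
  rw [coe_gSt_E, coe_E]
  refine congrArg₂ (· - ·) (toMmod_one_eq p k ?_) (toMmod_one_eq p k ?_)
  · simp [coe_h]
  · simp [coe_eps, coe_sG, coe_h]
    field_simp

lemma gSt_sG_E {x : F p} (hx : x ≠ 0) :
    gSt p k (sG p) (E p k x) = E p k (-x⁻¹) - E p k 0 := by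
  apply Subtype.ext
  rw [AddSubgroupClass.coe_sub, coe_gSt_E, coe_E, coe_E, sub_sub_sub_cancel_left]
  refine congrArg₂ (· - ·) (toMmod_one_eq p k ?_) (toMmod_one_eq p k ?_) <;>
    simp [coe_eps, coe_sG, hx]

end InducedModule

lemma gTT_ρ (g : G p) (x y : F p) : gTT p k g (ρ p k x y) =
    (2 : k)⁻¹ • (gSt p k g (E p k x) ⊗ₜ[k] gSt p k g (E p k y) -
      gSt p k g (E p k y) ⊗ₜ[k] gSt p k g (E p k x)) := by
  simp [gTT, ρ]

lemma gTT_eps_ρ (z x y : F p) : gTT p k (eps p z) (ρ p k x y) = ρ p k (z + x) (z + y) := by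
  rw [gTT_ρ, gSt_eps_E, gSt_eps_E, ρ]

lemma gTT_h_ρ (t : (F p)ˣ) (x y : F p) :
    gTT p k (h p t) (ρ p k x y) = ρ p k (t ^ 2 * x) (t ^ 2 * y) := by
  rw [gTT_ρ, gSt_h_E, gSt_h_E, ρ]

lemma gTT_sG_ρ {x y : F p} (hx : x ≠ 0) (hy : y ≠ 0) : gTT p k (sG p) (ρ p k x y) =
    ρ p k (-x⁻¹) (-y⁻¹) + ρ p k (-y⁻¹) 0 + ρ p k 0 (-x⁻¹) := by
  rw [gTT_ρ, gSt_sG_E p k hx, gSt_sG_E p k hy]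
  simp only [ρ, TensorProduct.sub_tmul, TensorProduct.tmul_sub]
  module

lemma ρ_add_ρ_swap (x y : F p) : ρ p k x y + ρ p k y x = 0 := by
  simp only [ρ]
  module

lemma ρ_mem (x y : F p) : ρ p k x y ∈ Vminus p k := by
  by_cases hxy : x = y
  · subst hxy
    simp [ρ]
  · exact Submodule.subset_span ⟨x, y, hxy, rfl⟩

/-- If `a (c + 1) = a c + A` for all but finitely many `c` in a field of characteristic `p`, with
`a` valued in characteristic zero, then `A = 0`. -/
lemma eq_zero_of_finite_add_one_ne (a : F p → k) (A : k)
    (hfin : {c : F p | a (c + 1) ≠ a c + A}.Finite) : A = 0 := by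
  have hbad : (⋃ i ∈ Finset.range p, (fun c : F p => c + (i : F p)) ⁻¹'
      {c : F p | a (c + 1) ≠ a c + A}).Finite :=
    (Finset.range p).finite_toSet.biUnion fun i _ =>
      hfin.preimage (add_left_injective (i : F p)).injOn
  obtain ⟨c, hc⟩ := hbad.exists_notMem
  have hstep : ∀ n ≤ p, a (c + n) = a c + n * A := by
    intro n
    induction n with
    | zero => simp
    | succ n ih =>
      intro hn
      have hcn : a (c + n + 1) = a (c + n) + A := by
        by_contra hne
        exact hc (Set.mem_biUnion (Finset.mem_coe.2 (Finset.mem_range.2 hn)) hne)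
      rw [Nat.cast_succ, ← add_assoc, hcn, ih (by omega)]
      push_cast
      ring
  have := hstep p le_rfl
  rw [CharP.cast_eq_zero (F p) p, add_zero, left_eq_add] at this
  exact (mul_eq_zero.1 this).resolve_left (Nat.cast_ne_zero.2 (Fact.out : p.Prime).ne_zero)

lemma eps_mem_B (z : F p) : eps p z ∈ B p := by
  change (_ : F p) = 0
  simp [eps]

lemma h_mem_B (t : (F p)ˣ) : h p t ∈ B p := by
  change (_ : F p) = 0
  simp [h]

lemma Bdiag_eps (z : F p) : Bdiag p ⟨eps p z, eps_mem_B p z⟩ = 1 := by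
  apply Units.ext
  simp [Bdiag, eps]

lemma Bdiag_h (t : (F p)ˣ) : Bdiag p ⟨h p t, h_mem_B p t⟩ = t := by
  apply Units.ext
  simp [Bdiag, h]

lemma exists_unit_sq {u : F p} (hu : u ≠ 0) : ∃ t : (F p)ˣ, (t : F p) ^ 2 = u := by
  obtain ⟨t, ht⟩ := IsAlgClosed.exists_pow_nat_eq u (n := 2) two_pos
  refine ⟨Units.mk0 t ?_, ht⟩
  rintro rfl
  exact hu (by simpa using ht.symm)

/-- for every nontrivial character `θ`, `Hom_{kG}(V₋, M(θ)) = 0`. -/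
theorem stmt16 (hp2 : p ≠ 2) (θ : (F p)ˣ →* kˣ) (hθ : θ ≠ 1)
    (hstab : ∀ (g : G p) (v : StT p k), v ∈ Vminus p k → gTT p k g v ∈ Vminus p k) :
    ∀ φ : ↥(Vminus p k) →ₗ[k] Mmod p k θ,
      (∀ (g : G p) (v : ↥(Vminus p k)),
        φ ⟨gTT p k g (v : StT p k), hstab g v v.2⟩ = γ p k g • φ v) → φ = 0 := by
  intro φ hφ
  let R : F p → F p → Vminus p k := fun x y => ⟨ρ p k x y, ρ_mem p k x y⟩
  let f : Vminus p k →ₗ[k] k := oneCoeff p k θ ∘ₗ φ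
  have hfg (g : G p) (v : Vminus p k) :
      f ⟨gTT p k g v, hstab g v v.2⟩ = oneCoeff p k θ (γ p k g • φ v) :=
    congrArg (oneCoeff p k θ) (hφ g v)
  have htrans (z x y : F p) : f (R (z + x) (z + y)) = f (R x y) := by
    have hR : R (z + x) (z + y) = ⟨gTT p k (eps p z) (R x y), hstab _ _ (R x y).2⟩ :=
      Subtype.ext (gTT_eps_ρ p k z x y).symm
    rw [hR, hfg]
    have := oneCoeff_smul p k θ ⟨eps p z, eps_mem_B p z⟩ (φ (R x y))
    rw [Bdiag_eps] at this
    rwa [map_one, Units.val_one, one_mul] at this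
  have htorus (t : (F p)ˣ) (x y : F p) : f (R (t ^ 2 * x) (t ^ 2 * y)) = θ t * f (R x y) := by
    have hR : R (t ^ 2 * x) (t ^ 2 * y) = ⟨gTT p k (h p t) (R x y), hstab _ _ (R x y).2⟩ :=
      Subtype.ext (gTT_h_ρ p k t x y).symm
    rw [hR, hfg]
    have := oneCoeff_smul p k θ ⟨h p t, h_mem_B p t⟩ (φ (R x y))
    rwa [Bdiag_h] at this
  have hneg (x y : F p) : f (R y x) = -f (R x y) := by
    have hR : R y x + R x y = 0 := Subtype.ext (ρ_add_ρ_swap p k y x)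
    rw [eq_neg_iff_add_eq_zero, ← map_add, hR, map_zero]
  let a : F p → k := fun u => f (R 0 u)
  have ha (x y : F p) : f (R x y) = a (y - x) := by
    rw [← htrans (-x) x y, neg_add_cancel, neg_add_eq_sub]
  have ha_neg (u : F p) : a (-u) = -a u := by
    rw [← zero_sub u, ← ha u 0, hneg 0 u]
  have ha_sq (t : (F p)ˣ) (u : F p) : a (t ^ 2 * u) = θ t * a u := by
    rw [← htorus t 0 u, mul_zero]
  have hs {x y : F p} (hx : x ≠ 0) (hy : y ≠ 0) :
      oneCoeff p k θ (γ p k (sG p) • φ (R x y)) = a (x⁻¹ - y⁻¹) + a y⁻¹ - a x⁻¹ := by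
    have hR : (⟨gTT p k (sG p) (R x y), hstab _ _ (R x y).2⟩ : Vminus p k) =
        R (-x⁻¹) (-y⁻¹) + R (-y⁻¹) 0 + R 0 (-x⁻¹) :=
      Subtype.ext (gTT_sG_ρ p k hx hy)
    rw [← hfg, hR, map_add, map_add, ha, ha _ 0, ha 0, sub_zero, zero_sub, neg_neg, ha_neg,
      neg_sub_neg, ← sub_eq_add_neg]
  have hone : a 1 = 0 := by
    refine eq_zero_of_finite_add_one_ne p k a (a 1) ?_
    refine ((finite_oneCoeff_ne_zero p k θ (φ (R 0 1))).union
      (Set.toFinite {0, -1})).subset fun c hc => ?_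
    by_contra hcon
    simp only [Set.mem_union, Set.mem_ofPred_eq, Set.mem_insert_iff, Set.mem_singleton_iff,
      not_or, not_not] at hcon
    obtain ⟨h0, hc0, hc1⟩ := hcon
    replace hc1 : c + 1 ≠ 0 := fun e => hc1 (eq_neg_of_add_eq_zero_left e)
    refine hc ?_
    have hR : γ p k (eps p c) • φ (R 0 1) = φ (R c (c + 1)) := by
      rw [← hφ]
      congr 1
      apply Subtype.ext
      simp only [R, gTT_eps_ρ, add_zero]
    rw [γ_mul, mul_smul, hR, hs hc0 hc1] at h0
    obtain ⟨t, ht⟩ := exists_unit_sq p (mul_ne_zero hc0 hc1)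
    have e1 := ha_sq t (c⁻¹ - (c + 1)⁻¹)
    have e2 := ha_sq t (c + 1)⁻¹
    have e3 := ha_sq t c⁻¹
    have f1 : (t : F p) ^ 2 * (c⁻¹ - (c + 1)⁻¹) = 1 := by rw [ht]; field_simp; ring
    have f2 : (t : F p) ^ 2 * (c + 1)⁻¹ = c := by rw [ht]; field_simp
    have f3 : (t : F p) ^ 2 * c⁻¹ = c + 1 := by rw [ht]; field_simp
    rw [f1] at e1
    rw [f2] at e2
    rw [f3] at e3
    rw [e1, e2, e3]
    linear_combination -(θ t : k) * h0
  have hf (x y : F p) (hxy : x ≠ y) : f (R x y) = 0 := by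
    obtain ⟨t, ht⟩ := exists_unit_sq p (sub_ne_zero.2 hxy.symm)
    rw [ha, ← ht, ← mul_one ((t : F p) ^ 2), ha_sq, hone, mul_zero]
  have hf0 (w : StT p k) (hw : w ∈ Vminus p k) : f ⟨w, hw⟩ = 0 := by
    induction hw using Submodule.span_induction with
    | mem w hw =>
      obtain ⟨x, y, hxy, rfl⟩ := hw
      exact hf x y hxy
    | zero => exact map_zero f
    | add u v hu hv ihu ihv =>
      exact (map_add f ⟨u, hu⟩ ⟨v, hv⟩).trans (by rw [ihu, ihv, add_zero])
    | smul c u hu ihu => exact (map_smul f c ⟨u, hu⟩).trans (by rw [ihu, smul_zero])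
  ext v
  refine eq_zero_of_oneCoeff_smul p k θ fun g => ?_
  rw [← hfg]
  exact hf0 _ _

end SL2X
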